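/- Suppose A is Γ-graded D-simple. Then for every α ∈ 𝒥 the operator d^α ∈ End_F(A) is nonzero. -/

import Mathlib

/-- A skew-symmetric bicharacter `ε : Γ × Γ → F^×`. -/
def IsBichar {F : Type} [Field F] {Γ : Type} [AddCommGroup Γ] (ε : Γ → Γ → F) : Prop :=
  (∀ lam mu, ε lam mu * ε mu lam = 1) ∧
  (∀ lam mu nu, ε lam (mu + nu) = ε lam mu * ε lam nu)

variable (F : Type) [Field F] (Γ : Type) [AddCommGroup Γ] [DecidableEq Γ]
  (A : Type) [Ring A] [Algebra F A]

/-- left multiplication operators -/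
noncomputable def mulL : A →ₗ[F] Module.End F A := (Algebra.lmul F A).toLinearMap

variable {F Γ A}

/-- `f ∈ End_F(A)` is homogeneous of degree `δ`. -/
def IsHomogMap (𝒜 : Γ → Submodule F A) (δ : Γ) (f : Module.End F A) : Prop :=
  ∀ lam : Γ, ∀ a ∈ 𝒜 lam, f a ∈ 𝒜 (lam + δ)

/-- `f` is a homogeneous color-derivation of degree `δ`. -/
def IsColorDer (𝒜 : Γ → Submodule F A) (ε : Γ → Γ → F) (δ : Γ) (f : Module.End F A) : Prop :=
  IsHomogMap 𝒜 δ f ∧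
  ∀ lam : Γ, ∀ a ∈ 𝒜 lam, ∀ b : A, f (a * b) = f a * b + ε δ lam • (a * f b)

/-- `Der^ε(A)`: the F-span of homogeneous color derivations. -/
def DerE (𝒜 : Γ → Submodule F A) (ε : Γ → Γ → F) : Submodule F (Module.End F A) :=
  Submodule.span F {f | ∃ δ, IsColorDer 𝒜 ε δ f}

/-- `A` is ε-commutative. -/
def IsColorComm (𝒜 : Γ → Submodule F A) (ε : Γ → Γ → F) : Prop :=
  ∀ lam mu : Γ, ∀ a ∈ 𝒜 lam, ∀ b ∈ 𝒜 mu, a * b = ε lam mu • (b * a)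

/-- `D` is color-commutative. -/
def DColorComm (𝒜 : Γ → Submodule F A) (ε : Γ → Γ → F) (D : Submodule F (Module.End F A)) : Prop :=
  ∀ δ δ' f g, f ∈ D → g ∈ D → IsColorDer 𝒜 ε δ f → IsColorDer 𝒜 ε δ' g →
    f * g = ε δ δ' • (g * f)

/-- `D` is a Γ-graded subspace: it is spanned by its homogeneous color-derivations. -/
def DGraded (𝒜 : Γ → Submodule F A) (ε : Γ → Γ → F) (D : Submodule F (Module.End F A)) : Prop :=
  D = Submodule.span F {f | f ∈ D ∧ ∃ δ, IsColorDer 𝒜 ε δ f}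

/-- `A[D]`: the unital subalgebra of `End_F(A)` generated by left multiplications and `D`. -/
noncomputable def AD (D : Submodule F (Module.End F A)) : Subalgebra F (Module.End F A) :=
  Algebra.adjoin F (Set.range (mulL F A) ∪ (D : Set (Module.End F A)))

/-- `A` is Γ-graded `D`-simple. -/
def GradedDSimple (𝒜 : Γ → Submodule F A) [GradedAlgebra 𝒜] (D : Submodule F (Module.End F A)) :
    Prop :=
  ∀ I : Ideal A, Ideal.IsHomogeneous 𝒜 I → (∀ f ∈ D, ∀ x ∈ I, f x ∈ I) → I = ⊥ ∨ I = ⊤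

/-- F₁ = A^D -/
def F1 (D : Submodule F (Module.End F A)) : Submodule F A where
  carrier := {u | ∀ f ∈ D, f u = 0}
  add_mem' := by
    intro a b ha hb f hf
    rw [map_add, ha f hf, hb f hf, add_zero]
  zero_mem' := by intro f hf; exact map_zero f
  smul_mem' := by
    intro c x hx f hf
    rw [map_smul, hx f hf, smul_zero]

/-- the derived space `W = [A[D], A[D]]`. -/
def Wsub (𝒜 : Γ → Submodule F A) (ε : Γ → Γ → F) (D : Submodule F (Module.End F A)) :
    Submodule F (Module.End F A) :=
  Submodule.span F {w | ∃ γ γ' x y, x ∈ AD D ∧ y ∈ AD D ∧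
    IsHomogMap 𝒜 γ x ∧ IsHomogMap 𝒜 γ' y ∧ w = x * y - ε γ γ' • (y * x)}

/-- `F₁[D]`. -/
noncomputable def F1D (D : Submodule F (Module.End F A)) : Subalgebra F (Module.End F A) :=
  Algebra.adjoin F ((mulL F A '' (F1 D : Set A)) ∪ (D : Set (Module.End F A)))

/-- `𝒟 = Der^ε(A) ∩ F₁[D]`. -/
def DScr (𝒜 : Γ → Submodule F A) (ε : Γ → Γ → F) (D : Submodule F (Module.End F A)) :
    Set (Module.End F A) :=
  {f | f ∈ F1D D ∧ f ∈ DerE 𝒜 ε}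

variable {I : Type} [LinearOrder I]

/-- ordered product `d^α`. -/
noncomputable def dpow (d : I → Module.End F A) (α : I →₀ ℕ) : Module.End F A :=
  ((α.support.sort (· ≤ ·)).map fun i => d i ^ α i).prod

/-- membership in the index set 𝒥. -/
def inJ (ε : Γ → Γ → F) (δd : I → Γ) (α : I →₀ ℕ) : Prop :=
  (∀ i, ringChar F ≠ 0 → α i ≤ ringChar F - 1) ∧
  (∀ i, ε (δd i) (δd i) = -1 → α i ≤ 1)

/-- the degree of `d^α`. -/
def degJ (δd : I → Γ) (α : I →₀ ℕ) : Γ := α.sum fun i n => n • δd i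

/-- the subalgebra `S` of `End_F(A)` is Γ-graded simple. -/
def GradedSimpleAlgOn (𝒜 : Γ → Submodule F A) (S : Subalgebra F (Module.End F A)) : Prop :=
  ∀ L : Submodule F (Module.End F A),
    L ≤ Subalgebra.toSubmodule S →
    (∀ x ∈ S, ∀ y ∈ L, x * y ∈ L ∧ y * x ∈ L) →
    L = Submodule.span F {f | f ∈ L ∧ ∃ δ, IsHomogMap 𝒜 δ f} →
    (L = ⊥ ∨ L = Subalgebra.toSubmodule S)

/-- variant of 𝒥 without characteristic restriction -/
def inJ0 (ε : Γ → Γ → F) (δd : I → Γ) (α : I →₀ ℕ) : Prop :=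
  ∀ i, ε (δd i) (δd i) = -1 → α i ≤ 1

/-- the sum `Σ_{α ∈ J0} B d^α` is direct -/
def DirectOn (d : I → Module.End F A) (J0 : Set (I →₀ ℕ)) (Bs : Set A) : Prop :=
  ∀ (s : Finset (I →₀ ℕ)) (c : (I →₀ ℕ) → A), ↑s ⊆ J0 → (∀ α ∈ s, c α ∈ Bs) →
    (∑ α ∈ s, mulL F A (c α) * dpow d α) = 0 → ∀ α ∈ s, mulL F A (c α) * dpow d α = 0

/-- span of color brackets of homogeneous elements of `M` and `N` -/
def brkE (𝒜 : Γ → Submodule F A) (ε : Γ → Γ → F) (M N : Submodule F (Module.End F A)) :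
    Submodule F (Module.End F A) :=
  Submodule.span F {w | ∃ γ γ' x y, x ∈ M ∧ y ∈ N ∧
    IsHomogMap 𝒜 γ x ∧ IsHomogMap 𝒜 γ' y ∧ w = x * y - ε γ γ' • (y * x)}

set_option linter.unusedSectionVars false

namespace IsBichar

variable {ε : Γ → Γ → F}

theorem ne_zero (h : IsBichar ε) (lam mu : Γ) : ε lam mu ≠ 0 :=
  left_ne_zero_of_mul_eq_one (h.1 lam mu)

theorem add_right (h : IsBichar ε) (lam mu nu : Γ) :
    ε lam (mu + nu) = ε lam mu * ε lam nu := h.2 lam mu nu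

theorem add_left (h : IsBichar ε) (lam mu nu : Γ) :
    ε (lam + mu) nu = ε lam nu * ε mu nu := by
  apply mul_right_cancel₀ (h.ne_zero nu (lam + mu))
  rw [h.1, h.add_right, mul_mul_mul_comm, h.1, h.1, one_mul]

theorem zero_right (h : IsBichar ε) (lam : Γ) : ε lam 0 = 1 := by
  apply mul_left_cancel₀ (h.ne_zero lam 0)
  rw [← h.add_right, add_zero, mul_one]

theorem zero_left (h : IsBichar ε) (lam : Γ) : ε 0 lam = 1 := by
  simpa [h.zero_right] using h.1 0 lam

theorem neg_left_mul (h : IsBichar ε) (lam mu : Γ) : ε (-lam) mu * ε lam mu = 1 := by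
  rw [← h.add_left, neg_add_cancel, h.zero_left]

end IsBichar

@[simp]
theorem mulL_apply (a b : A) : mulL F A a b = a * b := rfl

theorem mulL_mul (a b : A) : mulL F A (a * b) = mulL F A a * mulL F A b :=
  (Algebra.lmul F A).map_mul a b

section Twist

variable (𝒜 : Γ → Submodule F A) [GradedAlgebra 𝒜] (ε : Γ → Γ → F)

/-- The operator scaling the component of degree `lam` by `ε δ lam`. -/
noncomputable def twist (δ : Γ) : Module.End F A :=
  (DirectSum.toModule F Γ A fun lam => ε δ lam • (𝒜 lam).subtype) ∘ₗ
    (DirectSum.decomposeLinearEquiv 𝒜).toLinearMap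

variable {𝒜 ε}

theorem twist_of_mem (δ : Γ) {lam : Γ} {a : A} (ha : a ∈ 𝒜 lam) :
    twist 𝒜 ε δ a = ε δ lam • a := by
  lift a to 𝒜 lam using ha
  change DirectSum.toModule F Γ A _ (DirectSum.decompose 𝒜 (a : A)) = _
  rw [DirectSum.decompose_coe]
  exact DirectSum.toModule_lof (M := fun mu => 𝒜 mu)
    (φ := fun mu => ε δ mu • (𝒜 mu).subtype) F lam a

/-- Linear maps out of a graded algebra agree if they agree on homogeneous elements. -/
theorem end_ext_homogeneous {f g : Module.End F A}
    (h : ∀ lam, ∀ a ∈ 𝒜 lam, f a = g a) : f = g := by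
  ext a
  induction a using DirectSum.Decomposition.inductionOn 𝒜 with
  | zero => simp
  | homogeneous a => exact h _ _ a.2
  | add a b ha hb => simp [ha, hb]

theorem twist_mul_twist_neg (hb : IsBichar ε) (δ : Γ) :
    twist 𝒜 ε δ * twist 𝒜 ε (-δ) = 1 := by
  refine end_ext_homogeneous (𝒜 := 𝒜) fun lam a ha => ?_
  simp [twist_of_mem _ ha, smul_smul, hb.neg_left_mul]

theorem twist_mul (hb : IsBichar ε) (δ : Γ) {lam : Γ} {a : A} (ha : a ∈ 𝒜 lam) (b : A) :
    twist 𝒜 ε δ (a * b) = ε δ lam • (a * twist 𝒜 ε δ b) := by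
  induction b using DirectSum.Decomposition.inductionOn 𝒜 with
  | zero => simp
  | @homogeneous mu b =>
    rw [twist_of_mem _ (SetLike.mul_mem_graded ha b.2), twist_of_mem _ b.2, hb.add_right,
      mul_smul_comm, smul_smul]
  | add b c h₁ h₂ => simp [mul_add, h₁, h₂]

/-- The untwisted derivation satisfies a Leibniz rule valid for all elements. -/
theorem twist_neg_der_mul (hb : IsBichar ε) {δ : Γ} {x : Module.End F A}
    (hx : IsColorDer 𝒜 ε δ x) (c w : A) :
    twist 𝒜 ε (-δ) (x (c * w)) =
      twist 𝒜 ε (-δ) (x c * w) + c * twist 𝒜 ε (-δ) (x w) := by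
  induction c using DirectSum.Decomposition.inductionOn 𝒜 with
  | zero => simp
  | homogeneous c =>
    rw [hx.2 _ _ c.2, map_add, map_smul, twist_mul hb _ c.2, smul_smul, mul_comm,
      hb.neg_left_mul, one_smul]
  | add a b h₁ h₂ => simp only [add_mul, map_add, h₁, h₂]; abel

theorem IsColorDer.map_one (hb : IsBichar ε) {δ : Γ} {x : Module.End F A}
    (hx : IsColorDer 𝒜 ε δ x) : x 1 = 0 := by
  simpa [hb.zero_right] using hx.2 0 1 SetLike.GradedOne.one_mem 1

theorem F1D_commute_twist (hb : IsBichar ε) {D : Submodule F (Module.End F A)}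
    (hDgr : DGraded 𝒜 ε D) (hDcc : DColorComm 𝒜 ε D) {δ : Γ} {x : Module.End F A}
    (hxD : x ∈ D) (hx : IsColorDer 𝒜 ε δ x) {f : Module.End F A} (hf : f ∈ F1D D) :
    Commute f (twist 𝒜 ε (-δ) * x) := by
  suffices h : F1D D ≤ Subalgebra.centralizer F {twist 𝒜 ε (-δ) * x} from
    ((Subalgebra.mem_centralizer_iff F).1 (h hf) _ rfl).symm
  refine Algebra.adjoin_le (Set.union_subset ?_ ?_)
  · rintro _ ⟨u, hu, rfl⟩
    rw [SetLike.mem_coe, Subalgebra.mem_centralizer_iff]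
    rintro _ rfl
    ext w
    simp [twist_neg_der_mul hb hx, hu x hxD]
  · change D ≤ Subalgebra.toSubmodule (Subalgebra.centralizer F {twist 𝒜 ε (-δ) * x})
    rw [hDgr, Submodule.span_le]
    rintro g ⟨hgD, δ', hg⟩
    rw [SetLike.mem_coe, Subalgebra.mem_toSubmodule, Subalgebra.mem_centralizer_iff]
    rintro _ rfl
    refine end_ext_homogeneous (𝒜 := 𝒜) fun mu b hmu => ?_
    have hc : g (x b) = ε δ' δ • x (g b) := congr($(hDcc δ' δ g x hgD hxD hg hx) b)
    simp only [Module.End.mul_apply]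
    rw [twist_of_mem _ (hx.1 _ _ (hg.1 _ _ hmu)), twist_of_mem _ (hx.1 _ _ hmu), map_smul, hc,
      smul_smul]
    congr 1
    have h₁ : ε (-δ) δ' = ε δ' δ := by
      apply mul_right_cancel₀ (hb.ne_zero δ δ')
      rw [hb.neg_left_mul, hb.1]
    rw [hb.add_right, hb.add_right, hb.add_right, h₁]
    ring

end Twist

section Independence

variable {𝒜 : Γ → Submodule F A} [GradedAlgebra 𝒜] {ε : Γ → Γ → F}
  {D : Submodule F (Module.End F A)} {d : I → Module.End F A} {δd : I → Γ}

theorem sum_der_mulL_eq_zero (hb : IsBichar ε) (hDgr : DGraded 𝒜 ε D) (hDcc : DColorComm 𝒜 ε D)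
    (hdD : ∀ i, d i ∈ F1D D) {s : Finset I} {c : I → A}
    (hc : ∑ i ∈ s, mulL F A (c i) * d i = 0) {x : Module.End F A} (hx : x ∈ D) :
    ∑ i ∈ s, mulL F A (x (c i)) * d i = 0 := by
  rw [hDgr] at hx
  induction hx using Submodule.span_induction with
  | mem x hx =>
    obtain ⟨hxD, δ, hx⟩ := hx
    ext b
    have hcomm : ∀ i, twist 𝒜 ε (-δ) (x (d i b)) = d i (twist 𝒜 ε (-δ) (x b)) := fun i =>
      congr($((F1D_commute_twist hb hDgr hDcc hxD hx (hdD i)).eq.symm) b)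
    have hval : ∀ w, ∑ i ∈ s, c i * d i w = 0 := fun w => by
      simpa [LinearMap.sum_apply] using congr($hc w)
    have h : twist 𝒜 ε (-δ) (x (∑ i ∈ s, c i * d i b)) = 0 := by
      rw [hval, map_zero, map_zero]
    rw [map_sum, map_sum] at h
    simp only [twist_neg_der_mul hb hx, hcomm, Finset.sum_add_distrib, hval,
      add_zero] at h
    rw [← map_sum] at h
    have h' := congr(twist 𝒜 ε δ $h)
    rw [map_zero, ← Module.End.mul_apply, twist_mul_twist_neg hb] at h'
    simpa [LinearMap.sum_apply] using h'
  | zero => simp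
  | add x y _ _ h₁ h₂ => simp [add_mul, Finset.sum_add_distrib, h₁, h₂]
  | smul r x _ h => simp [← Finset.smul_sum, h]

/-- The ideal of coefficients at `i` of the `A`-linear relations supported on `s`. -/
def coeffIdeal (d : I → Module.End F A) (s : Finset I) (i : I) : Ideal A where
  carrier := {b | ∃ c : I → A, c i = b ∧ ∑ j ∈ s, mulL F A (c j) * d j = 0}
  add_mem' := by
    rintro _ _ ⟨c, rfl, hc⟩ ⟨e, rfl, he⟩
    exact ⟨c + e, rfl, by simp [add_mul, Finset.sum_add_distrib, hc, he]⟩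
  zero_mem' := ⟨0, rfl, by simp⟩
  smul_mem' := by
    rintro r _ ⟨c, rfl, hc⟩
    refine ⟨fun j => r * c j, rfl, ?_⟩
    simp only [mulL_mul, mul_assoc, ← Finset.mul_sum, hc, mul_zero]

theorem coeffIdeal_isHomogeneous (hdhom : ∀ i, IsColorDer 𝒜 ε (δd i) (d i)) (s : Finset I)
    (i : I) : (coeffIdeal d s i).IsHomogeneous 𝒜 := by
  rintro eta _ ⟨c, rfl, hc⟩
  refine ⟨fun j => DirectSum.decompose 𝒜 (c j) (eta + δd i - δd j),
    by beta_reduce; rw [add_sub_cancel_right], ?_⟩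
  refine end_ext_homogeneous (𝒜 := 𝒜) fun mu b hmu => ?_
  have hval : ∑ j ∈ s, c j * d j b = 0 := by
    simpa [LinearMap.sum_apply] using congr($hc b)
  have h := congr(GradedRing.proj 𝒜 (eta + δd i + mu) $hval)
  simp only [map_sum, map_zero, GradedRing.proj_apply] at h
  simp only [LinearMap.sum_apply, Module.End.mul_apply, mulL_apply, LinearMap.zero_apply]
  refine Eq.trans (Finset.sum_congr rfl fun j _ => ?_) h
  rw [← DirectSum.coe_decompose_mul_add_of_right_mem 𝒜 ((hdhom j).1 _ _ hmu),
    show eta + δd i - δd j + (mu + δd j) = eta + δd i + mu by abel]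

/-- In a graded `D`-simple algebra, independence over the constants implies independence
over `A`. -/
theorem linearIndependent_of_F1 [Nontrivial A] (hb : IsBichar ε) (hDgr : DGraded 𝒜 ε D)
    (hDcc : DColorComm 𝒜 ε D) (hsimple : GradedDSimple 𝒜 D) (hdD : ∀ i, d i ∈ F1D D)
    (hdhom : ∀ i, IsColorDer 𝒜 ε (δd i) (d i))
    (hdind : ∀ (s : Finset I) (c : I → A), (∀ i, c i ∈ F1 D) →
      (∑ i ∈ s, mulL F A (c i) * d i) = 0 → ∀ i ∈ s, c i = 0)
    (s : Finset I) : ∀ c : I → A, ∑ i ∈ s, mulL F A (c i) * d i = 0 → ∀ i ∈ s, c i = 0 := by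
  induction s using Finset.induction_on with
  | empty => simp
  | insert i t hi ih =>
    rcases hsimple (coeffIdeal d (insert i t) i) (coeffIdeal_isHomogeneous hdhom _ _) (by
      rintro x hx _ ⟨c, rfl, hc⟩
      exact ⟨fun j => x (c j), rfl, sum_der_mulL_eq_zero hb hDgr hDcc hdD hc hx⟩) with hJ | hJ
    · intro c hc
      have hci : c i = 0 := by
        have : c i ∈ coeffIdeal d (insert i t) i := ⟨c, rfl, hc⟩
        rwa [hJ] at this
      rw [Finset.sum_insert hi, hci, map_zero, zero_mul, zero_add] at hc
      simpa [hci] using ih c hc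
    · exfalso
      obtain ⟨c, hci, hc⟩ : (1 : A) ∈ coeffIdeal d (insert i t) i := by rw [hJ]; trivial
      have hone : (1 : A) ∈ F1 D := by
        intro x hx
        rw [hDgr] at hx
        induction hx using Submodule.span_induction with
        | mem x hx => exact hx.2.choose_spec.map_one hb
        | zero => rfl
        | add x y _ _ h₁ h₂ => simp [h₁, h₂]
        | smul r x _ h => simp [h]
      have hmem : ∀ j ∈ insert i t, c j ∈ F1 D := by
        intro j hj
        rcases Finset.mem_insert.1 hj with rfl | hj
        · rwa [hci]
        · intro x hx
          have h := sum_der_mulL_eq_zero hb hDgr hDcc hdD hc hx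
          rw [Finset.sum_insert hi, hci, hone x hx, map_zero, zero_mul, zero_add] at h
          exact ih _ h j hj
      have h := hdind (insert i t) (fun j => if j ∈ insert i t then c j else 0) (fun j => by
        split_ifs with hj
        · exact hmem j hj
        · exact zero_mem _) (by
          rw [← hc]
          exact Finset.sum_congr rfl fun j hj => by rw [if_pos hj]) i (Finset.mem_insert_self i t)
      rw [if_pos (Finset.mem_insert_self i t), hci] at h
      exact one_ne_zero h

end Independence

section Order

variable {𝒜 : Γ → Submodule F A} {ε : Γ → Γ → F}

/-- The color commutator of an operator of degree `η` with multiplication by an element `a` of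
degree `lam`. -/
noncomputable def colorBracket (ε : Γ → Γ → F) (η lam : Γ) (a : A) :
    Module.End F A →ₗ[F] Module.End F A :=
  LinearMap.mulRight F (mulL F A a) - ε η lam • LinearMap.mulLeft F (mulL F A a)

theorem colorBracket_apply (η lam : Γ) (a : A) (f : Module.End F A) :
    colorBracket ε η lam a f = f * mulL F A a - ε η lam • (mulL F A a * f) := rfl

/-- Operators of (virtual) degree `η` annihilated by all `n`-fold color commutators with
homogeneous multiplications, i.e. color differential operators of order less than `n`. -/
noncomputable def diffOrd (𝒜 : Γ → Submodule F A) (ε : Γ → Γ → F) :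
    ℕ → Γ → Submodule F (Module.End F A)
  | 0, _ => ⊥
  | n + 1, η => ⨅ lam, ⨅ a : 𝒜 lam, (diffOrd 𝒜 ε n (η + lam)).comap (colorBracket ε η lam (a : A))

theorem mem_diffOrd_zero {η : Γ} {f : Module.End F A} : f ∈ diffOrd 𝒜 ε 0 η ↔ f = 0 := by
  simp [diffOrd]

theorem mem_diffOrd_succ {n : ℕ} {η : Γ} {f : Module.End F A} :
    f ∈ diffOrd 𝒜 ε (n + 1) η ↔
      ∀ lam, ∀ a ∈ 𝒜 lam, colorBracket ε η lam a f ∈ diffOrd 𝒜 ε n (η + lam) := by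
  simp [diffOrd, Submodule.mem_iInf]

theorem mulL_swap (hcomm : IsColorComm 𝒜 ε) {lam mu : Γ} {a b : A} (ha : a ∈ 𝒜 lam)
    (hb : b ∈ 𝒜 mu) : mulL F A a * mulL F A b = ε lam mu • (mulL F A b * mulL F A a) := by
  rw [← mulL_mul, ← mulL_mul, hcomm _ _ _ ha _ hb, map_smul]

theorem der_mul_mulL {δ : Γ} {x : Module.End F A} (hx : IsColorDer 𝒜 ε δ x) {lam : Γ} {a : A}
    (ha : a ∈ 𝒜 lam) : x * mulL F A a = mulL F A (x a) + ε δ lam • (mulL F A a * x) := by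
  ext b
  simp [hx.2 _ _ ha]

theorem colorBracket_mulL_mul (hbich : IsBichar ε) (hcomm : IsColorComm 𝒜 ε) {η lam mu : Γ}
    {a b : A} (ha : a ∈ 𝒜 lam) (hb : b ∈ 𝒜 mu) (f : Module.End F A) :
    colorBracket ε (mu + η) lam a (mulL F A b * f) =
      mulL F A b * colorBracket ε η lam a f := by
  simp only [colorBracket_apply]
  rw [← mul_assoc (mulL F A a), mulL_swap hcomm ha hb, hbich.add_left, mul_sub, smul_mul_assoc,
    smul_smul, mul_right_comm, hbich.1, one_mul, mul_smul_comm, mul_assoc, mul_assoc]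

theorem colorBracket_mul_mulL (hbich : IsBichar ε) (hcomm : IsColorComm 𝒜 ε) {η lam mu : Γ}
    {a b : A} (ha : a ∈ 𝒜 lam) (hb : b ∈ 𝒜 mu) (f : Module.End F A) :
    colorBracket ε (η + mu) lam a (f * mulL F A b) =
      ε mu lam • (colorBracket ε η lam a f * mulL F A b) := by
  simp only [colorBracket_apply]
  rw [mul_assoc f, mulL_swap hcomm hb ha, hbich.add_left, sub_mul, smul_sub, mul_smul_comm,
    smul_mul_assoc, smul_smul, mul_comm (ε mu lam) (ε η lam), mul_assoc, mul_assoc]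

theorem colorBracket_der_mul (hbich : IsBichar ε) {δ η lam : Γ} {x : Module.End F A}
    (hx : IsColorDer 𝒜 ε δ x) {a : A} (ha : a ∈ 𝒜 lam) (f : Module.End F A) :
    colorBracket ε (δ + η) lam a (x * f) =
      x * colorBracket ε η lam a f + ε η lam • (mulL F A (x a) * f) := by
  simp only [colorBracket_apply]
  rw [mul_sub, mul_smul_comm, ← mul_assoc x (mulL F A a) f, der_mul_mulL hx ha, hbich.add_left,
    add_mul, smul_add, smul_mul_assoc, smul_smul, mul_comm (ε η lam) (ε δ lam), mul_assoc,
    mul_assoc]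
  abel

theorem mulL_mul_mem_diffOrd (hbich : IsBichar ε) (hcomm : IsColorComm 𝒜 ε) {n : ℕ} {η mu : Γ}
    {b : A} (hb : b ∈ 𝒜 mu) {f : Module.End F A} (hf : f ∈ diffOrd 𝒜 ε n η) :
    mulL F A b * f ∈ diffOrd 𝒜 ε n (mu + η) := by
  induction n generalizing η f with
  | zero => rw [mem_diffOrd_zero] at hf ⊢; rw [hf, mul_zero]
  | succ n ih =>
    rw [mem_diffOrd_succ] at hf ⊢
    intro lam a ha
    rw [colorBracket_mulL_mul hbich hcomm ha hb, add_assoc]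
    exact ih (hf lam a ha)

theorem der_mul_mem_diffOrd (hbich : IsBichar ε) (hcomm : IsColorComm 𝒜 ε) {n : ℕ} {δ η : Γ}
    {x : Module.End F A} (hx : IsColorDer 𝒜 ε δ x) {f : Module.End F A}
    (hf : f ∈ diffOrd 𝒜 ε n η) : x * f ∈ diffOrd 𝒜 ε (n + 1) (δ + η) := by
  induction n generalizing η f with
  | zero => rw [mem_diffOrd_zero.1 hf, mul_zero]; exact zero_mem _
  | succ n ih =>
    rw [mem_diffOrd_succ]
    intro lam a ha
    rw [colorBracket_der_mul hbich hx ha]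
    refine add_mem ?_ (Submodule.smul_mem _ _ ?_)
    · rw [add_assoc]
      exact ih (mem_diffOrd_succ.1 hf lam a ha)
    · have h := mulL_mul_mem_diffOrd hbich hcomm (hx.1 _ _ ha) hf
      rwa [show lam + δ + η = δ + η + lam by abel] at h

theorem der_mul_mem_diffOrd_of_pred (hbich : IsBichar ε) (hcomm : IsColorComm 𝒜 ε) {n : ℕ}
    {δ η : Γ} {x : Module.End F A} (hx : IsColorDer 𝒜 ε δ x) {f : Module.End F A}
    (hf : f ∈ diffOrd 𝒜 ε (n - 1) η) : x * f ∈ diffOrd 𝒜 ε n (δ + η) := by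
  cases n with
  | zero => rw [mem_diffOrd_zero.1 hf, mul_zero]; exact zero_mem _
  | succ n => exact der_mul_mem_diffOrd hbich hcomm hx hf

theorem IsHomogMap.colorBracket [SetLike.GradedMonoid 𝒜] {η lam : Γ} {f : Module.End F A}
    (hf : IsHomogMap 𝒜 η f) {a : A} (ha : a ∈ 𝒜 lam) :
    IsHomogMap 𝒜 (η + lam) (colorBracket ε η lam a f) := by
  intro mu b hb
  refine sub_mem ?_ (Submodule.smul_mem _ _ ?_)
  · have h := hf _ _ (SetLike.mul_mem_graded ha hb)
    rwa [show lam + mu + η = mu + (η + lam) by abel] at h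
  · have h := SetLike.mul_mem_graded ha (hf _ _ hb)
    rwa [show lam + (mu + η) = mu + (η + lam) by abel] at h

theorem IsHomogMap.mul {η η' : Γ} {f g : Module.End F A} (hf : IsHomogMap 𝒜 η f)
    (hg : IsHomogMap 𝒜 η' g) : IsHomogMap 𝒜 (η + η') (f * g) := by
  intro mu b hb
  rw [add_comm η, ← add_assoc]
  exact hf _ _ (hg _ _ hb)

end Order

section Symbol

variable {𝒜 : Γ → Submodule F A} {ε : Γ → Γ → F} {d : I → Module.End F A} {δd : I → Γ}

/-- If a combination of operators of order at most `n` with `A`-independent derivations drops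
order, then so does each of the operators. -/
theorem mem_diffOrd_of_sum_mem [GradedAlgebra 𝒜] (hbich : IsBichar ε) (hcomm : IsColorComm 𝒜 ε)
    (hdhom : ∀ i, IsColorDer 𝒜 ε (δd i) (d i)) {s : Finset I}
    (hind : ∀ c : I → A, ∑ i ∈ s, mulL F A (c i) * d i = 0 → ∀ i ∈ s, c i = 0)
    (n : ℕ) {η : Γ} {f : I → Module.End F A} (hfhom : ∀ j, IsHomogMap 𝒜 (η - δd j) (f j))
    (hf : ∀ j, f j ∈ diffOrd 𝒜 ε (n + 1) (η - δd j))
    (hsum : ∀ lam, ∀ a ∈ 𝒜 lam, ∑ j ∈ s, f j * mulL F A (d j a) ∈ diffOrd 𝒜 ε n (η + lam)) :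
    ∀ j ∈ s, f j ∈ diffOrd 𝒜 ε n (η - δd j) := by
  induction n generalizing η f with
  | zero =>
    have hval : ∀ j lam, ∀ b ∈ 𝒜 lam, f j b = f j 1 * b := by
      intro j lam b hb
      have h := mem_diffOrd_zero.1 (mem_diffOrd_succ.1 (hf j) lam b hb)
      have h1 := congr($h 1)
      simp only [colorBracket_apply, LinearMap.sub_apply, Module.End.mul_apply, mulL_apply,
        LinearMap.smul_apply, mul_one, LinearMap.zero_apply, sub_eq_zero] at h1
      have hone : f j 1 ∈ 𝒜 (η - δd j) := by
        simpa using hfhom j 0 1 SetLike.GradedOne.one_mem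
      rw [h1, hcomm _ _ _ hb _ hone, smul_smul, hbich.1, one_smul]
    have hrel : ∑ j ∈ s, mulL F A (f j 1) * d j = 0 := by
      refine end_ext_homogeneous (𝒜 := 𝒜) fun lam a ha => ?_
      have h := congr($(mem_diffOrd_zero.1 (hsum lam a ha)) 1)
      simp only [LinearMap.sum_apply, Module.End.mul_apply, mulL_apply, mul_one,
        LinearMap.zero_apply] at h ⊢
      rw [← h]
      exact Finset.sum_congr rfl fun j _ => (hval j _ _ ((hdhom j).1 _ _ ha)).symm
    intro j hj
    rw [mem_diffOrd_zero]
    refine end_ext_homogeneous (𝒜 := 𝒜) fun lam a ha => ?_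
    rw [hval j lam a ha, hind _ hrel j hj, zero_mul, LinearMap.zero_apply]
  | succ n ih =>
    intro j hj
    rw [mem_diffOrd_succ]
    intro mu c hc
    have hdeg : ∀ k, η - δd k + mu = η + mu - δd k := fun k => by abel
    have key := ih (η := η + mu)
      (f := fun k => ε (δd k) mu • colorBracket ε (η - δd k) mu c (f k))
      (fun k lam a ha => Submodule.smul_mem _ _ (by
        have h := (hfhom k).colorBracket (ε := ε) hc lam a ha
        rwa [hdeg] at h))
      (fun k => Submodule.smul_mem _ _ (by
        have h := mem_diffOrd_succ.1 (hf k) mu c hc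
        rwa [hdeg] at h))
      (fun lam a ha => by
        have h := mem_diffOrd_succ.1 (hsum lam a ha) mu c hc
        have h' := Submodule.smul_mem _ (ε mu lam) h
        rw [show η + lam + mu = η + mu + lam by abel, map_sum, Finset.smul_sum] at h'
        convert h' using 1
        refine Finset.sum_congr rfl fun k _ => ?_
        have e : η + lam = η - δd k + (lam + δd k) := by abel
        rw [e, colorBracket_mul_mulL hbich hcomm hc ((hdhom k).1 _ _ ha), smul_smul,
          hbich.add_left, ← mul_assoc, hbich.1, one_mul, smul_mul_assoc]) j hj
    have h := Submodule.smul_mem _ (ε mu (δd j)) key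
    rwa [smul_smul, hbich.1, one_smul, ← hdeg] at h

/-- The degree of a word in the derivations. -/
def wordDeg (δd : I → Γ) (L : List I) : Γ := (L.map δd).sum

/-- The operator given by a word in the derivations. -/
def wordOp (d : I → Module.End F A) (L : List I) : Module.End F A := (L.map d).prod

/-- The component at `j` of the symbol of a word: to leading order, the color commutator of the
word with `a` is `∑ j, wordSymbol L j * d j a`. -/
def wordSymbol (ε : Γ → Γ → F) (d : I → Module.End F A) (δd : I → Γ) :
    List I → I → Module.End F A
  | [], _ => 0
  | i :: L, j => d i * wordSymbol ε d δd L j +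
      if i = j then ε (δd i) (wordDeg δd L) • wordOp d L else 0

theorem wordDeg_cons (i : I) (L : List I) : wordDeg δd (i :: L) = δd i + wordDeg δd L := by
  simp [wordDeg]

theorem wordOp_cons (i : I) (L : List I) : wordOp d (i :: L) = d i * wordOp d L := by
  simp [wordOp]

theorem wordOp_isHomogMap (hdhom : ∀ i, IsColorDer 𝒜 ε (δd i) (d i)) (L : List I) :
    IsHomogMap 𝒜 (wordDeg δd L) (wordOp d L) := by
  induction L with
  | nil => intro lam a ha; simpa [wordOp, wordDeg] using ha
  | cons i L ih => rw [wordDeg_cons, wordOp_cons]; exact (hdhom i).1.mul ih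

theorem wordSymbol_isHomogMap (hdhom : ∀ i, IsColorDer 𝒜 ε (δd i) (d i)) (L : List I) (j : I) :
    IsHomogMap 𝒜 (wordDeg δd L - δd j) (wordSymbol ε d δd L j) := by
  induction L with
  | nil => intro lam a ha; exact zero_mem _
  | cons i L ih =>
    intro lam a ha
    rw [wordDeg_cons]
    refine add_mem ?_ ?_
    · rw [add_sub_assoc]; exact (hdhom i).1.mul ih lam a ha
    · split_ifs with hij
      · subst hij
        rw [add_sub_cancel_left]
        exact Submodule.smul_mem _ _ (wordOp_isHomogMap hdhom L lam a ha)
      · exact zero_mem _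

theorem wordOp_mem_diffOrd (hbich : IsBichar ε) (hcomm : IsColorComm 𝒜 ε)
    (hdhom : ∀ i, IsColorDer 𝒜 ε (δd i) (d i)) (L : List I) :
    wordOp d L ∈ diffOrd 𝒜 ε (L.length + 1) (wordDeg δd L) := by
  induction L with
  | nil =>
    refine mem_diffOrd_succ.2 fun lam a ha => ?_
    simp [wordOp, wordDeg, colorBracket_apply, hbich.zero_left]
  | cons i L ih =>
    rw [wordDeg_cons, wordOp_cons]
    exact der_mul_mem_diffOrd hbich hcomm (hdhom i) ih

theorem wordSymbol_mem_diffOrd (hbich : IsBichar ε) (hcomm : IsColorComm 𝒜 ε)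
    (hdhom : ∀ i, IsColorDer 𝒜 ε (δd i) (d i)) (L : List I) (j : I) :
    wordSymbol ε d δd L j ∈ diffOrd 𝒜 ε L.length (wordDeg δd L - δd j) := by
  induction L with
  | nil => exact zero_mem _
  | cons i L ih =>
    rw [wordDeg_cons]
    refine add_mem ?_ ?_
    · rw [add_sub_assoc]; exact der_mul_mem_diffOrd hbich hcomm (hdhom i) ih
    · split_ifs with hij
      · subst hij
        rw [add_sub_cancel_left]
        exact Submodule.smul_mem _ _ (wordOp_mem_diffOrd hbich hcomm hdhom L)
      · exact zero_mem _

theorem colorBracket_wordOp_sub_mem (hbich : IsBichar ε) (hcomm : IsColorComm 𝒜 ε)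
    (hdhom : ∀ i, IsColorDer 𝒜 ε (δd i) (d i)) {s : Finset I} {lam : Γ} {a : A}
    (ha : a ∈ 𝒜 lam) (L : List I) (hL : ∀ i ∈ L, i ∈ s) :
    colorBracket ε (wordDeg δd L) lam a (wordOp d L) -
        ∑ j ∈ s, wordSymbol ε d δd L j * mulL F A (d j a) ∈
      diffOrd 𝒜 ε (L.length - 1) (wordDeg δd L + lam) := by
  induction L with
  | nil =>
    simp [wordOp, wordDeg, wordSymbol, colorBracket_apply, hbich.zero_left]
  | cons i L ih =>
    have hi : i ∈ s := hL i (by simp)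
    have hE := der_mul_mem_diffOrd_of_pred hbich hcomm (hdhom i)
      (ih fun k hk => hL k (by simp [hk]))
    have hW := Submodule.smul_mem _ (ε (δd i) (wordDeg δd L))
      (mem_diffOrd_succ.1 (wordOp_mem_diffOrd hbich hcomm hdhom L) _ _ ((hdhom i).1 _ _ ha))
    rw [← add_assoc] at hE
    rw [show wordDeg δd L + (lam + δd i) = δd i + wordDeg δd L + lam by abel] at hW
    have hsub := sub_mem hE hW
    rw [wordDeg_cons, wordOp_cons, List.length_cons, Nat.add_sub_cancel]
    convert hsub using 1
    rw [colorBracket_der_mul hbich (hdhom i) ha, colorBracket_apply (lam := lam + δd i), mul_sub,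
      smul_sub, smul_smul, hbich.add_right, mul_left_comm, hbich.1, mul_one]
    simp only [wordSymbol, add_mul, Finset.sum_add_distrib, ite_mul, zero_mul,
      Finset.sum_ite_eq, hi, if_true, Finset.mul_sum, mul_assoc, smul_mul_assoc]
    abel

theorem wordSymbol_eq_zero_of_notMem {L : List I} {j : I} (hj : j ∉ L) :
    wordSymbol ε d δd L j = 0 := by
  induction L with
  | nil => rfl
  | cons i L ih =>
    simp only [List.mem_cons, not_or] at hj
    simp [wordSymbol, ih hj.2, Ne.symm hj.1]

theorem wordDeg_replicate_append (m : ℕ) (i : I) (Q : List I) :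
    wordDeg δd (List.replicate m i ++ Q) = m • δd i + wordDeg δd Q := by
  simp [wordDeg]

theorem IsBichar.nsmul_right (h : IsBichar ε) (lam mu : Γ) (m : ℕ) :
    ε lam (m • mu) = ε lam mu ^ m := by
  induction m with
  | zero => simp [h.zero_right]
  | succ m ih => rw [succ_nsmul, h.add_right, ih, pow_succ]

theorem wordSymbol_replicate_append (hbich : IsBichar ε) (m : ℕ) {i : I} {Q : List I}
    (hi : i ∉ Q) :
    wordSymbol ε d δd (List.replicate (m + 1) i ++ Q) i =
      ((∑ k ∈ Finset.range (m + 1), ε (δd i) (δd i) ^ k) * ε (δd i) (wordDeg δd Q)) •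
        wordOp d (List.replicate m i ++ Q) := by
  induction m with
  | zero => simp [wordSymbol, wordSymbol_eq_zero_of_notMem hi]
  | succ m ih =>
    rw [List.replicate_succ, List.cons_append, wordSymbol, ih, if_pos rfl,
      Finset.sum_range_succ _ (m + 1), wordDeg_replicate_append, hbich.add_right,
      hbich.nsmul_right, mul_smul_comm, ← wordOp_cons, ← List.cons_append,
      ← List.replicate_succ, ← add_smul, add_mul]

/-- The `q`-integers occurring in symbols of admissible monomials do not vanish. -/
theorem geom_sum_bichar_ne_zero (hbich : IsBichar ε) {δ : Γ} {m n : ℕ} (hmn : m < n)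
    (hchar : ringChar F ≠ 0 → n ≤ ringChar F - 1) (hodd : ε δ δ = -1 → n ≤ 1) :
    ∑ k ∈ Finset.range (m + 1), ε δ δ ^ k ≠ 0 := by
  rcases mul_self_eq_one_iff.1 (hbich.1 δ δ) with h | h
  · simp only [h, one_pow, Finset.sum_const, Finset.card_range, nsmul_eq_mul, mul_one]
    intro h0
    have hdvd := (ringChar.spec F (m + 1)).1 h0
    by_cases hp : ringChar F = 0
    · rw [hp, zero_dvd_iff] at hdvd
      omega
    · have h1 := Nat.le_of_dvd (Nat.succ_pos m) hdvd
      have h2 := hchar hp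
      omega
  · have := hodd h
    obtain rfl : m = 0 := by omega
    simp

theorem wordOp_flatMap_notMem_diffOrd [Nontrivial A] [GradedAlgebra 𝒜] (hbich : IsBichar ε)
    (hcomm : IsColorComm 𝒜 ε) (hdhom : ∀ i, IsColorDer 𝒜 ε (δd i) (d i))
    (hind : ∀ (s : Finset I) (c : I → A),
      ∑ i ∈ s, mulL F A (c i) * d i = 0 → ∀ i ∈ s, c i = 0)
    {α : I →₀ ℕ} (hα : inJ ε δd α) (l : List I) (hl : l.Nodup) :
    wordOp d (l.flatMap fun i => List.replicate (α i) i) ∉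
      diffOrd 𝒜 ε (l.flatMap fun i => List.replicate (α i) i).length
        (wordDeg δd (l.flatMap fun i => List.replicate (α i) i)) := by
  induction l with
  | nil => simp [mem_diffOrd_zero, wordOp]
  | cons i l ih =>
    obtain ⟨hi, hl⟩ := List.nodup_cons.1 hl
    rw [List.flatMap_cons]
    have hiQ : i ∉ l.flatMap fun i => List.replicate (α i) i := by
      simp only [List.mem_flatMap, List.mem_replicate, not_exists, not_and]
      rintro k hk _ rfl
      exact hi hk
    generalize (l.flatMap fun i => List.replicate (α i) i) = Q at hiQ ih
    suffices h : ∀ m ≤ α i, wordOp d (List.replicate m i ++ Q) ∉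
        diffOrd 𝒜 ε (List.replicate m i ++ Q).length (wordDeg δd (List.replicate m i ++ Q)) from
      h _ le_rfl
    intro m
    induction m with
    | zero => intro _; simpa using ih hl
    | succ m ihm =>
      intro hm hmem
      refine ihm (by omega) ?_
      have hs : i ∈ (List.replicate (m + 1) i ++ Q).toFinset := by simp
      have key := mem_diffOrd_of_sum_mem hbich hcomm hdhom
        (hind (List.replicate (m + 1) i ++ Q).toFinset)
        (List.replicate m i ++ Q).length
        (fun j => wordSymbol_isHomogMap hdhom (List.replicate (m + 1) i ++ Q) j)
        (fun j => wordSymbol_mem_diffOrd hbich hcomm hdhom (List.replicate (m + 1) i ++ Q) j)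
        (fun lam a ha => by
          have h₁ := colorBracket_wordOp_sub_mem hbich hcomm hdhom ha
            (List.replicate (m + 1) i ++ Q) (fun k hk => List.mem_toFinset.2 hk)
          have h₂ := mem_diffOrd_succ.1 hmem lam a ha
          have h := sub_mem h₂ h₁
          rwa [sub_sub_cancel] at h) i hs
      rw [wordSymbol_replicate_append hbich m hiQ, Submodule.smul_mem_iff _
        (mul_ne_zero (geom_sum_bichar_ne_zero hbich hm (hα.1 i) (hα.2 i))
          (hbich.ne_zero _ _)), List.replicate_succ, List.cons_append, wordDeg_cons,
        add_sub_cancel_left] at key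
      exact key

theorem dpow_eq_wordOp (α : I →₀ ℕ) :
    dpow d α = wordOp d ((α.support.sort (· ≤ ·)).flatMap fun i => List.replicate (α i) i) := by
  rw [dpow, wordOp]
  induction α.support.sort (· ≤ ·) with
  | nil => rfl
  | cons i l ih => simp [ih]

end Symbol

theorem stmt_8
    (𝒜 : Γ → Submodule F A) [GradedAlgebra 𝒜] (ε : Γ → Γ → F)
    (D : Submodule F (Module.End F A))
    (hchar : (2 : F) ≠ 0)
    (hbich : IsBichar ε)
    (hcomm : IsColorComm 𝒜 ε)
    (hDder : D ≤ DerE 𝒜 ε)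
    (hDgr : DGraded 𝒜 ε D)
    (hDcc : DColorComm 𝒜 ε D)
    (hDne : D ≠ ⊥)
    (hsimple : GradedDSimple 𝒜 D)
    (d : I → Module.End F A) (δd : I → Γ)
    (hdD : ∀ i, d i ∈ DScr 𝒜 ε D)
    (hdhom : ∀ i, IsColorDer 𝒜 ε (δd i) (d i))
    (hdspan : ∀ f ∈ DScr 𝒜 ε D, ∃ (s : Finset I) (c : I → A),
      (∀ i, c i ∈ F1 D) ∧ f = ∑ i ∈ s, mulL F A (c i) * d i)
    (hdind : ∀ (s : Finset I) (c : I → A), (∀ i, c i ∈ F1 D) →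
      (∑ i ∈ s, mulL F A (c i) * d i) = 0 → ∀ i ∈ s, c i = 0)
    :
    ∀ α : I →₀ ℕ, inJ ε δd α → dpow d α ≠ 0 := by
  intro α hα h0
  have : Nontrivial A := by
    by_contra h
    rw [not_nontrivial_iff_subsingleton] at h
    exact hDne (Submodule.eq_bot_iff _ |>.2 fun f _ => by ext a; exact Subsingleton.elim _ _)
  refine wordOp_flatMap_notMem_diffOrd hbich hcomm hdhom
    (linearIndependent_of_F1 hbich hDgr hDcc hsimple (fun i => (hdD i).1) hdhom hdind) hα
    (α.support.sort (· ≤ ·)) (Finset.sort_nodup _ _) ?_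
  rw [← dpow_eq_wordOp, h0]
  exact zero_mem _
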